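/- Let N be a positive integer, let p_1, …, p_N be nonnegative real numbers, and let c_1, …, c_N be a probability distribution on {1,…,N} with Σ_{i=1}^N c_i p_i > 0. For integers k ≥ 1 define S_k := (Σ_{i=1}^N c_i p_i^k) / (Σ_{i=1}^N c_i p_i^{k-1}). Then for all integers k* ≥ k ≥ 1, one has Σ_{i=1}^N c_i p_i^k ≤ (S_{k*})^k. -/

import Mathlib

theorem stmt_3 (N : ℕ) (hN : 0 < N) (p c : Fin N → ℝ)
    (hp : ∀ i, 0 ≤ p i) (hc : ∀ i, 0 ≤ c i) (hcsum : ∑ i, c i = 1)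
    (hpos : 0 < ∑ i, c i * p i)
    (S : ℕ → ℝ)
    (hS : ∀ k : ℕ, 1 ≤ k →
      S k = (∑ i, c i * p i ^ k) / (∑ i, c i * p i ^ (k - 1))) :
    ∀ k kstar : ℕ, 1 ≤ k → k ≤ kstar →
      ∑ i, c i * p i ^ k ≤ (S kstar) ^ k := by
  obtain ⟨i₀, -, hi₀⟩ := Finset.exists_lt_of_sum_lt (s := Finset.univ)
    (f := fun _ : Fin N => (0 : ℝ)) (g := fun i => c i * p i) (by simpa using hpos)
  have hc0 : 0 < c i₀ := (hc i₀).lt_of_ne (fun h => by simp [← h] at hi₀)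
  have hp0 : 0 < p i₀ := (hp i₀).lt_of_ne (fun h => by simp [← h] at hi₀)
  obtain ⟨M, hM⟩ : ∃ M : ℕ → ℝ, ∀ k, M k = ∑ i, c i * p i ^ k := ⟨_, fun _ => rfl⟩
  have hMpos : ∀ k, 0 < M k := by
    intro k
    rw [hM]
    exact Finset.sum_pos' (fun i _ => mul_nonneg (hc i) (pow_nonneg (hp i) k))
      ⟨i₀, Finset.mem_univ _, by positivity⟩
  have hS' : ∀ k, S (k + 1) = M (k + 1) / M k := by
    intro k
    rw [hS _ (by omega), hM, hM, Nat.add_sub_cancel]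
  have hCS : ∀ k, M (k + 1) ^ 2 ≤ M k * M (k + 2) := by
    intro k
    rw [hM, hM, hM]
    refine Finset.sum_sq_le_sum_mul_sum_of_sq_eq_mul _
      (fun i _ => mul_nonneg (hc i) (pow_nonneg (hp i) _))
      (fun i _ => mul_nonneg (hc i) (pow_nonneg (hp i) _)) (fun i _ => by ring)
  have hmono : Monotone (fun k => S (k + 1)) := by
    refine monotone_nat_of_le_succ fun k => ?_
    simp only [hS']
    rw [div_le_div_iff₀ (hMpos _) (hMpos _)]
    nlinarith [hCS k]
  intro k kstar hk hkk
  rw [← hM]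
  have hSpos : 0 < S kstar := by
    obtain ⟨m, rfl⟩ : ∃ m, kstar = m + 1 := ⟨kstar - 1, by omega⟩
    rw [hS']
    exact div_pos (hMpos _) (hMpos _)
  clear hk
  induction k with
  | zero => simp [hM, hcsum]
  | succ k ih =>
    obtain ⟨m, rfl⟩ : ∃ m, kstar = m + 1 := ⟨kstar - 1, by omega⟩
    have h1 : S (k + 1) ≤ S (m + 1) := hmono (by omega : k ≤ m)
    have h2 := ih (by omega)
    rw [hS' k, div_le_iff₀ (hMpos k)] at h1
    calc M (k + 1) ≤ S (m + 1) * M k := h1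
      _ ≤ S (m + 1) * S (m + 1) ^ k := by gcongr
      _ = S (m + 1) ^ (k + 1) := by ring
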